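/- arXiv:math/0411081 — 2 statements merged into one kernel-verified Lean document; each statement's English description precedes it below -/
import Mathlib

section
/- Fix an integer m ≥ 1 and y ∈ ℂ with y ≠ 0 and y ≠ 1. For each integer N ≥ 2 and all sufficiently small ε > 0, the value χ_N(y) = (1/(1−y)) · (1/(2πi)) ∮_{|z|=ε} (1−e^{−mz})/(1−y e^{−mz}) · ((1−y e^{−z})/(1−e^{−z}))^N dz is independent of ε, and there exists δ > 0 such that for every t ∈ ℂ with |t| < δ, the series ∑_{N=2}^∞ χ_N(y) · t^{N−1} converges with sum equal to ((1−yt)^m − (1−t)^m) / (((1−yt)^m − y(1−t)^m)·(1−t)(1−yt)). -/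
open Complex
open Filter Topology

/-- A property holding near `0` holds on every sufficiently small circle around `0`, and more
precisely on the closed disc it bounds. -/
lemma eventually_forall_mem_closedBall {P : ℂ → Prop} (h : ∀ᶠ z in 𝓝 (0 : ℂ), P z) :
    ∀ᶠ ε in 𝓝[>] (0 : ℝ), 0 < ε ∧ ∀ z ∈ Metric.closedBall (0 : ℂ) ε, P z := by
  obtain ⟨δ, hδ, hP⟩ := Metric.eventually_nhds_iff_ball.1 h
  filter_upwards [Ioo_mem_nhdsGT hδ] with ε hε
  exact ⟨hε.1, fun z hz => hP z (Metric.closedBall_subset_ball hε.2 hz)⟩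

lemma ne_zero_of_mem_sphere_zero {ε : ℝ} (hε : 0 < ε) {z : ℂ}
    (hz : z ∈ Metric.sphere (0 : ℂ) ε) : z ≠ 0 :=
  ne_zero_of_mem_sphere hε.ne' ⟨z, hz⟩

lemma AnalyticAt.eventually_circleIntegral_eq_zero {f : ℂ → ℂ} (hf : AnalyticAt ℂ f 0) :
    ∀ᶠ ε in 𝓝[>] (0 : ℝ), CircleIntegrable f 0 ε ∧ ∮ z in C(0, ε), f z = 0 := by
  filter_upwards [eventually_forall_mem_closedBall hf.eventually_analyticAt] with ε ⟨hε, h⟩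
  have hd : DifferentiableOn ℂ f (Metric.closedBall 0 ε) :=
    fun z hz => (h z hz).differentiableAt.differentiableWithinAt
  refine ⟨(hd.continuousOn.mono Metric.sphere_subset_closedBall).circleIntegrable hε.le, ?_⟩
  exact Complex.circleIntegral_eq_zero_of_differentiable_on_off_countable hε.le Set.countable_empty
    hd.continuousOn fun z hz => (h z (Metric.ball_subset_closedBall hz.1)).differentiableAt

section LocalCoordinate

variable {T : ℂ → ℂ}

lemma AnalyticAt.dslope_self {f : ℂ → ℂ} {a : ℂ} (hf : AnalyticAt ℂ f a) :
    AnalyticAt ℂ (dslope f a) a := by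
  obtain ⟨p, hp⟩ := hf
  exact ⟨_, hp.has_fpower_series_dslope_fslope⟩

lemma eq_mul_dslope_zero (h0 : T 0 = 0) (z : ℂ) : T z = z * dslope T 0 z := by
  simpa [h0] using (sub_smul_dslope T 0 z).symm

/-- A local coordinate vanishing at `0` is nonzero on small punctured discs. -/
lemma eventually_ne_zero_of_deriv_ne_zero (hT : AnalyticAt ℂ T 0) (h0 : T 0 = 0)
    (h1 : deriv T 0 ≠ 0) : ∀ᶠ z in 𝓝 (0 : ℂ), z ≠ 0 → T z ≠ 0 := by
  have hu : dslope T 0 0 ≠ 0 := by rwa [dslope_same]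
  filter_upwards [hT.dslope_self.continuousAt.eventually_ne hu] with z hz hz0
  rw [eq_mul_dslope_zero h0]
  exact mul_ne_zero hz0 hz

lemma eventually_circleIntegral_logDeriv (hT : AnalyticAt ℂ T 0) (h0 : T 0 = 0)
    (h1 : deriv T 0 ≠ 0) :
    ∀ᶠ ε in 𝓝[>] (0 : ℝ), ∮ z in C(0, ε), deriv T z / T z = 2 * Real.pi * I := by
  have hua := hT.dslope_self
  have hu : dslope T 0 0 ≠ 0 := by rwa [dslope_same]
  filter_upwards [(hua.deriv.div hua hu).eventually_circleIntegral_eq_zero,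
    eventually_forall_mem_closedBall (hua.continuousAt.eventually_ne hu),
    eventually_forall_mem_closedBall hua.eventually_analyticAt] with ε ⟨hi, hz⟩ ⟨hε, hne⟩ ⟨_, ha⟩
  have key : Set.EqOn (fun z => deriv T z / T z)
      (fun z => (z - 0)⁻¹ + (deriv (dslope T 0) / dslope T 0) z) (Metric.sphere 0 ε) := by
    intro z hzs
    have hzb := Metric.sphere_subset_closedBall hzs
    have hz0 := ne_zero_of_mem_sphere_zero hε hzs
    have hd : HasDerivAt T (1 * dslope T 0 z + z * deriv (dslope T 0) z) z := by
      have := (hasDerivAt_id' z).fun_mul (ha z hzb).differentiableAt.hasDerivAt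
      rwa [← funext (eq_mul_dslope_zero h0)] at this
    have := hne z hzb
    simp only [hd.deriv, Pi.div_apply]
    rw [eq_mul_dslope_zero h0 z]
    field_simp
    ring
  rw [circleIntegral.integral_congr hε.le key, circleIntegral.integral_add _ hi, hz,
    circleIntegral.integral_sub_center_inv _ hε.ne', add_zero]
  refine ContinuousOn.circleIntegrable hε.le
    (ContinuousOn.inv₀ (f := fun z => z - 0) (by fun_prop) fun z hzs => ?_)
  simpa using ne_zero_of_mem_sphere_zero hε hzs

lemma eventually_circleIntegral_deriv_div_pow (hT : AnalyticAt ℂ T 0) (h0 : T 0 = 0)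
    (h1 : deriv T 0 ≠ 0) (n : ℕ) :
    ∀ᶠ ε in 𝓝[>] (0 : ℝ), ∮ z in C(0, ε), deriv T z / T z ^ (n + 2) = 0 := by
  filter_upwards [eventually_forall_mem_closedBall hT.eventually_analyticAt,
    eventually_forall_mem_closedBall (eventually_ne_zero_of_deriv_ne_zero hT h0 h1)]
    with ε ⟨hε, ha⟩ ⟨_, hne⟩
  refine circleIntegral.integral_eq_zero_of_hasDerivWithinAt
    (f := fun z => -((n : ℂ) + 1)⁻¹ * (T z ^ (n + 1))⁻¹) hε.le fun z hzs => ?_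
  have hzb := Metric.sphere_subset_closedBall hzs
  have hTz := hne z hzb (ne_zero_of_mem_sphere_zero hε hzs)
  have hn : (n : ℂ) + 1 ≠ 0 := Nat.cast_add_one_ne_zero n
  have hd := (((ha z hzb).differentiableAt.hasDerivAt.fun_pow (n + 1)).fun_inv
    (pow_ne_zero _ hTz)).const_mul (-((n : ℂ) + 1)⁻¹)
  convert hd.hasDerivWithinAt using 1
  push_cast
  field_simp
  ring

/-- The `n`-th Taylor coefficient of `G` as a residue in an arbitrary local coordinate `T`. -/
lemma eventually_circleIntegral_comp_mul_deriv_div_pow (hT : AnalyticAt ℂ T 0) (h0 : T 0 = 0)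
    (h1 : deriv T 0 ≠ 0) (n : ℕ) {G : ℂ → ℂ} {p : FormalMultilinearSeries ℂ ℂ ℂ}
    (hG : HasFPowerSeriesAt G p 0) :
    ∀ᶠ ε in 𝓝[>] (0 : ℝ),
      ∮ z in C(0, ε), G (T z) * deriv T z / T z ^ (n + 1) = 2 * Real.pi * I * p.coeff n := by
  have hcont {g : ℂ → ℂ} (hg : AnalyticAt ℂ g 0) (k : ℕ) : ∀ᶠ ε in 𝓝[>] (0 : ℝ),
      CircleIntegrable (fun z => g (T z) * deriv T z / T z ^ k) 0 ε := by
    have hgT : AnalyticAt ℂ (fun z => g (T z)) 0 := AnalyticAt.fun_comp (by rwa [h0]) hT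
    filter_upwards [eventually_forall_mem_closedBall hT.eventually_analyticAt,
      eventually_forall_mem_closedBall hgT.eventually_analyticAt,
      eventually_forall_mem_closedBall (eventually_ne_zero_of_deriv_ne_zero hT h0 h1)]
      with ε ⟨hε, ha⟩ ⟨_, hga⟩ ⟨_, hne⟩
    refine ContinuousOn.circleIntegrable hε.le fun z hzs => ContinuousAt.continuousWithinAt ?_
    have hzb := Metric.sphere_subset_closedBall hzs
    exact ((hga z hzb).continuousAt.mul (ha z hzb).deriv.continuousAt).div
      ((ha z hzb).continuousAt.pow k)
      (pow_ne_zero _ (hne z hzb (ne_zero_of_mem_sphere_zero hε hzs)))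
  have hsplit (k : ℕ) {G : ℂ → ℂ} (hG : AnalyticAt ℂ G 0) : ∀ᶠ ε in 𝓝[>] (0 : ℝ),
      ∮ z in C(0, ε), G (T z) * deriv T z / T z ^ (k + 1) =
        G 0 * (∮ z in C(0, ε), deriv T z / T z ^ (k + 1)) +
          ∮ z in C(0, ε), dslope G 0 (T z) * deriv T z / T z ^ k := by
    filter_upwards [hcont hG.dslope_self k, hcont (analyticAt_const (v := G 0)) (k + 1),
      eventually_forall_mem_closedBall (eventually_ne_zero_of_deriv_ne_zero hT h0 h1)]
      with ε hi hi' ⟨hε, hne⟩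
    rw [← circleIntegral.integral_const_mul]
    simp only [← mul_div_assoc]
    rw [← circleIntegral.integral_add hi' hi]
    refine circleIntegral.integral_congr hε.le fun z hzs => ?_
    have hTz := hne z (Metric.sphere_subset_closedBall hzs) (ne_zero_of_mem_sphere_zero hε hzs)
    have hG' : G (T z) = G 0 + T z * dslope G 0 (T z) := by
      have := sub_smul_dslope G 0 (T z)
      simp only [sub_zero, smul_eq_mul] at this
      rw [this]
      ring
    simp only [hG']
    field_simp
    ring
  induction n generalizing G p with
  | zero =>
    have hreg : AnalyticAt ℂ (fun z => dslope G 0 (T z) * deriv T z) 0 :=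
      (AnalyticAt.fun_comp (by rw [h0]; exact hG.analyticAt.dslope_self) hT).mul hT.deriv
    filter_upwards [hsplit 0 hG.analyticAt, eventually_circleIntegral_logDeriv hT h0 h1,
      hreg.eventually_circleIntegral_eq_zero] with ε h h' h''
    have hc : p.coeff 0 = G 0 := hG.coeff_zero _
    simp only [zero_add, pow_one, pow_zero, div_one] at h ⊢
    rw [h, h', h''.2, hc]
    ring
  | succ n ih =>
    filter_upwards [hsplit (n + 1) hG.analyticAt,
      eventually_circleIntegral_deriv_div_pow hT h0 h1 n,
      ih hG.has_fpower_series_dslope_fslope] with ε h h' h''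
    rw [h, h', h'', FormalMultilinearSeries.coeff_fslope]
    ring

end LocalCoordinate

section

variable {y : ℂ}

lemma hasDerivAt_one_sub_exp_div {z : ℂ} (hz : 1 - y * exp (-z) ≠ 0) :
    HasDerivAt (fun z => (1 - exp (-z)) / (1 - y * exp (-z)))
      ((1 - y) * exp (-z) / (1 - y * exp (-z)) ^ 2) z := by
  have he : HasDerivAt (fun z : ℂ => exp (-z)) (exp (-z) * -1) z := (hasDerivAt_neg z).cexp
  refine ((he.const_sub 1).fun_div ((he.const_mul y).const_sub 1) hz).congr_deriv ?_
  ring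

/-- The substitution `t = (1 - w) / (1 - y w)` in the generating function. -/
lemma generatingFunction_comp (m : ℕ) (hy1 : y ≠ 1) {w : ℂ} (hw0 : w ≠ 0)
    (hw : 1 - y * w ≠ 0) :
    ((1 - y * ((1 - w) / (1 - y * w))) ^ m - (1 - (1 - w) / (1 - y * w)) ^ m) /
        (((1 - y * ((1 - w) / (1 - y * w))) ^ m - y * (1 - (1 - w) / (1 - y * w)) ^ m) *
          ((1 - (1 - w) / (1 - y * w)) * (1 - y * ((1 - w) / (1 - y * w))))) *
      ((1 - y) * w / (1 - y * w) ^ 2) =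
    (1 - y)⁻¹ * ((1 - w ^ m) / (1 - y * w ^ m)) := by
  have hy : 1 - y ≠ 0 := sub_ne_zero.2 hy1.symm
  have e1 : 1 - y * ((1 - w) / (1 - y * w)) = (1 - y) / (1 - y * w) := by
    field_simp
    ring
  have e2 : 1 - (1 - w) / (1 - y * w) = (1 - y) / (1 - y * w) * w := by
    rw [div_mul_eq_mul_div, eq_div_iff hw, sub_mul, div_mul_cancel₀ _ hw]
    ring
  set c := (1 - y) / (1 - y * w) with hc
  have hc0 : c ≠ 0 := div_ne_zero hy hw
  have e3 : (1 - y) * w / (1 - y * w) ^ 2 = (1 - y)⁻¹ * (c * w * c) := by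
    rw [hc]
    field_simp
  rw [e1, e2, e3, mul_pow, show c ^ m - c ^ m * w ^ m = c ^ m * (1 - w ^ m) by ring,
    show c ^ m - y * (c ^ m * w ^ m) = c ^ m * (1 - y * w ^ m) by ring, mul_assoc (c ^ m),
    mul_div_mul_left _ _ (pow_ne_zero m hc0), mul_left_comm, div_mul_eq_mul_div,
    mul_div_mul_right _ _ (mul_ne_zero (mul_ne_zero hc0 hw0) hc0)]

end

/-- The Hirzebruch `χ_{−y}`-genera of smooth degree-`m` hypersurfaces in
`ℂP^{N-1}`, expressed as residues (independent of the small radius `ε`), have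
generating series `((1−yt)^m − (1−t)^m)/(((1−yt)^m − y(1−t)^m)(1−t)(1−yt))`. -/
theorem chi_y_genus_hypersurface_generating_series
    (m : ℕ) (hm : 1 ≤ m) (y : ℂ) (hy0 : y ≠ 0) (hy1 : y ≠ 1) :
    ∃ χ : ℕ → ℂ,
      (∀ N : ℕ, 2 ≤ N →
        ∀ᶠ ε in nhdsWithin (0 : ℝ) (Set.Ioi 0),
          χ N =
            (1 - y)⁻¹ *
              ((2 * (Real.pi : ℂ) * I)⁻¹ *
                ∮ z in C(0, ε),
                  (1 - exp (-((m : ℂ) * z))) / (1 - y * exp (-((m : ℂ) * z))) *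
                    ((1 - y * exp (-z)) / (1 - exp (-z))) ^ N)) ∧
      ∃ δ > (0 : ℝ), ∀ t : ℂ, ‖t‖ < δ →
        HasSum (fun n : ℕ => χ (n + 2) * t ^ (n + 1))
          (((1 - y * t) ^ m - (1 - t) ^ m) /
            (((1 - y * t) ^ m - y * (1 - t) ^ m) * ((1 - t) * (1 - y * t)))) := by
  have hy : 1 - y ≠ 0 := sub_ne_zero.2 hy1.symm
  obtain ⟨p, hp⟩ : AnalyticAt ℂ (fun t : ℂ => ((1 - y * t) ^ m - (1 - t) ^ m) /
      (((1 - y * t) ^ m - y * (1 - t) ^ m) * ((1 - t) * (1 - y * t)))) 0 :=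
    AnalyticAt.fun_div (by fun_prop) (by fun_prop) (by simpa using hy)
  refine ⟨fun N => p.coeff (N - 1), fun N hN => ?_, ?_⟩
  · set T : ℂ → ℂ := fun z => (1 - exp (-z)) / (1 - y * exp (-z)) with hTdef
    have hT : AnalyticAt ℂ T 0 :=
      AnalyticAt.fun_div (by fun_prop) (by fun_prop) (by simpa using hy)
    have h0 : T 0 = 0 := by simp [hTdef]
    have h1 : deriv T 0 ≠ 0 := by
      rw [(hasDerivAt_one_sub_exp_div (by simpa using hy)).deriv]
      simpa using hy
    have hden : ∀ᶠ z in 𝓝 (0 : ℂ), 1 - y * exp (-z) ≠ 0 :=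
      ContinuousAt.eventually_ne (by fun_prop) (by simpa using hy)
    obtain ⟨n, rfl⟩ : ∃ n, N = n + 1 := ⟨N - 1, by omega⟩
    filter_upwards [eventually_circleIntegral_comp_mul_deriv_div_pow hT h0 h1 n hp,
      eventually_forall_mem_closedBall hden] with ε h ⟨hε, hne⟩
    rw [mul_left_comm, ← circleIntegral.integral_const_mul, eq_inv_mul_iff_mul_eq₀
      Complex.two_pi_I_ne_zero, add_tsub_cancel_right, ← h]
    refine circleIntegral.integral_congr hε.le fun z hzs => ?_
    have hz := hne z (Metric.sphere_subset_closedBall hzs)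
    have hw : exp (-((m : ℂ) * z)) = exp (-z) ^ m := by
      rw [← Complex.exp_nat_mul]
      ring_nf
    simp only [(hasDerivAt_one_sub_exp_div hz).deriv, hTdef]
    rw [generatingFunction_comp m hy1 (exp_ne_zero _) hz, hw, div_eq_mul_inv _ (_ ^ (n + 1)),
      ← inv_pow, inv_div, mul_assoc]
  · obtain ⟨δ, hδ, hsum⟩ := Metric.eventually_nhds_iff_ball.1 (hasFPowerSeriesAt_iff.1 hp)
    refine ⟨δ, hδ, fun t ht => ?_⟩
    have hc : p.coeff 0 = 0 := (hp.coeff_zero _).trans (by simp)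
    have := (hasSum_nat_add_iff' 1).2 (hsum t (by simpa using ht))
    simpa [hc, mul_comm] using this
end

section
/- Fix τ ∈ ℂ with Im τ > 0, v ∈ ℂ, and integers m ≥ 1 and N ≥ 2 such that (N−m)·v is an integer. Assume θ(v,τ) ≠ 0 and that for all integers a, b with 0 ≤ a, b ≤ m−1 one has θ((−v+a+bτ)/m, τ) ≠ 0 and θ(((m−1)v+a+bτ)/m, τ) ≠ 0. Then for all sufficiently small ε > 0, −(1/G(e^{2πiv}, e^{2πiτ})) · ∮_{|z|=ε} θ(mz,τ)/θ(v+mz,τ) · (θ(v+z,τ)/θ(z,τ))^N dz = (1/m) · ∑_{a=0}^{m−1} ∑_{b=0}^{m−1} e^{2πibv} · ( θ(((m−1)v+a+bτ)/m, τ) / θ((−v+a+bτ)/m, τ) )^N. -/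
open Complex

/-- The Jacobi theta function
`θ(v,τ) = i·e^{πiτ/4}·e^{−πiv}·∏_{k≥1}(1−q^k)(1−q^{k−1}e^{2πiv})(1−q^k e^{−2πiv})`,
where `q = e^{2πiτ}`. -/
noncomputable def theta (v τ : ℂ) : ℂ :=
  I * exp ((Real.pi : ℂ) * I * τ / 4) * exp (-((Real.pi : ℂ) * I * v)) *
    ∏' k : ℕ,
      (1 - exp (2 * (Real.pi : ℂ) * I * τ) ^ (k + 1)) *
      (1 - exp (2 * (Real.pi : ℂ) * I * τ) ^ k * exp (2 * (Real.pi : ℂ) * I * v)) *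
      (1 - exp (2 * (Real.pi : ℂ) * I * τ) ^ (k + 1) * exp (-(2 * (Real.pi : ℂ) * I * v)))

/-- `G(y, q) = y^{-1/2}·∏_{k≥1}(1−yq^{k−1})(1−y⁻¹q^k)/(1−q^k)²`, written as a
function of `v` and `τ` with `y = e^{2πiv}`, `q = e^{2πiτ}`,
`y^{-1/2} = e^{−πiv}`. -/
noncomputable def Gfun (v τ : ℂ) : ℂ :=
  exp (-((Real.pi : ℂ) * I * v)) *
    ∏' k : ℕ,
      (1 - exp (2 * (Real.pi : ℂ) * I * v) * exp (2 * (Real.pi : ℂ) * I * τ) ^ k) *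
        (1 - (exp (2 * (Real.pi : ℂ) * I * v))⁻¹ * exp (2 * (Real.pi : ℂ) * I * τ) ^ (k + 1)) /
        (1 - exp (2 * (Real.pi : ℂ) * I * τ) ^ (k + 1)) ^ 2

section QProduct

/-- The infinite product `∏_{k ≥ 0} (1 - q ^ k * y)`. -/
noncomputable def qProd (q y : ℂ) : ℂ := ∏' k : ℕ, (1 - q ^ k * y)

variable {q : ℂ}

lemma summable_norm_pow_mul (hq : ‖q‖ < 1) (y : ℂ) : Summable fun k : ℕ => ‖-(q ^ k * y)‖ := by
  simpa using (summable_geometric_of_lt_one (norm_nonneg _) hq).mul_right ‖y‖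

lemma multipliable_qProd (hq : ‖q‖ < 1) (y : ℂ) : Multipliable fun k : ℕ => 1 - q ^ k * y := by
  simpa [sub_eq_add_neg] using multipliable_one_add_of_summable (summable_norm_pow_mul hq y)

lemma qProd_eq_mul (hq : ‖q‖ < 1) (y : ℂ) : qProd q y = (1 - y) * qProd q (q * y) := by
  have h := tprod_eq_zero_mul' (f := fun k : ℕ => 1 - q ^ k * y)
    (by simpa [pow_succ, mul_assoc] using multipliable_qProd hq (q * y))
  simpa [qProd, pow_succ, mul_assoc] using h

lemma qProd_ne_zero (hq : ‖q‖ < 1) {y : ℂ} (hy : ∀ k : ℕ, q ^ k * y ≠ 1) : qProd q y ≠ 0 := by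
  have h := tprod_one_add_ne_zero_of_summable (f := fun k : ℕ => -(q ^ k * y))
    (fun k => by simpa [← sub_eq_add_neg, sub_ne_zero] using (hy k).symm)
    (summable_norm_pow_mul hq y)
  simpa [qProd, sub_eq_add_neg] using h

lemma differentiable_qProd (hq : ‖q‖ < 1) : Differentiable ℂ (qProd q) := by
  have key : HasProdLocallyUniformlyOn (fun (k : ℕ) (y : ℂ) => 1 + -(q ^ k * y))
      (fun y => ∏' k : ℕ, (1 + -(q ^ k * y))) Set.univ := by
    apply hasProdLocallyUniformlyOn_of_forall_compact isOpen_univ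
    intro K _ hK
    obtain ⟨R, hR⟩ := hK.isBounded.exists_norm_le
    refine ((summable_geometric_of_lt_one (norm_nonneg _) hq).mul_right
      R).hasProdUniformlyOn_nat_one_add hK (.of_forall fun n x hx => ?_) (fun _ => by fun_prop)
    rw [norm_neg, norm_mul, norm_pow]
    exact mul_le_mul_of_nonneg_left (hR x hx) (by positivity)
  have h := key.differentiableOn
    (.of_forall fun _ => by simpa [Finset.prod_fn] using
      DifferentiableOn.finsetProd (fun _ _ => by fun_prop)) isOpen_univ
  have h2 : qProd q = fun y => ∏' k : ℕ, (1 + -(q ^ k * y)) := by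
    funext y; simp [qProd, sub_eq_add_neg]
  rw [h2]
  exact differentiableOn_univ.mp h

end QProduct

section Theta

variable {τ : ℂ}

/-- The nome `q = e^{2πiτ}`. -/
noncomputable def nome (τ : ℂ) : ℂ := exp (2 * (Real.pi : ℂ) * I * τ)

lemma norm_nome_lt_one (hτ : 0 < τ.im) : ‖nome τ‖ < 1 := by
  simpa [nome] using UpperHalfPlane.norm_exp_two_pi_I_lt_one ⟨τ, hτ⟩

lemma theta_eq_qProd (hτ : 0 < τ.im) (v : ℂ) :
    theta v τ = I * exp ((Real.pi : ℂ) * I * τ / 4) * exp (-((Real.pi : ℂ) * I * v)) *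
      (qProd (nome τ) (nome τ) * qProd (nome τ) (exp (2 * (Real.pi : ℂ) * I * v)) *
        qProd (nome τ) (nome τ * exp (-(2 * (Real.pi : ℂ) * I * v)))) := by
  have hq := norm_nome_lt_one hτ
  have h1 := multipliable_qProd hq (nome τ)
  have h2 := multipliable_qProd hq (exp (2 * (Real.pi : ℂ) * I * v))
  have h3 := multipliable_qProd hq (nome τ * exp (-(2 * (Real.pi : ℂ) * I * v)))
  rw [theta, qProd, qProd, qProd, ← h1.tprod_mul h2, ← (h1.mul h2).tprod_mul h3]
  simp only [nome, pow_succ, mul_assoc]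

lemma qProd_nome_ne_zero (hτ : 0 < τ.im) : qProd (nome τ) (nome τ) ≠ 0 := by
  refine qProd_ne_zero (norm_nome_lt_one hτ) fun k hk => ?_
  have : ‖nome τ ^ k * nome τ‖ < 1 := by
    rw [← pow_succ, norm_pow]
    exact pow_lt_one₀ (norm_nonneg _) (norm_nome_lt_one hτ) (by omega)
  simp [hk] at this

lemma differentiable_theta (hτ : 0 < τ.im) : Differentiable ℂ fun v => theta v τ := by
  simp_rw [theta_eq_qProd hτ]
  have h := differentiable_qProd (norm_nome_lt_one hτ)
  have h1 : Differentiable ℂ fun v : ℂ => qProd (nome τ) (exp (2 * (Real.pi : ℂ) * I * v)) :=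
    h.comp (by fun_prop)
  have h2 : Differentiable ℂ fun v : ℂ =>
      qProd (nome τ) (nome τ * exp (-(2 * (Real.pi : ℂ) * I * v))) :=
    h.comp (by fun_prop)
  fun_prop

lemma theta_add_one (hτ : 0 < τ.im) (v : ℂ) : theta (v + 1) τ = -theta v τ := by
  have e1 : exp (2 * (Real.pi : ℂ) * I * (v + 1)) = exp (2 * (Real.pi : ℂ) * I * v) := by
    rw [mul_add, mul_one, exp_add, exp_two_pi_mul_I, mul_one]
  have e2 : exp (-((Real.pi : ℂ) * I * (v + 1))) = -exp (-((Real.pi : ℂ) * I * v)) := by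
    rw [mul_add, mul_one, neg_add, exp_add, exp_neg (Real.pi * I), exp_pi_mul_I]
    norm_num
  rw [theta_eq_qProd hτ, theta_eq_qProd hτ, exp_neg (2 * _ * _ * (v + 1)), e1, e2, ← exp_neg]
  ring

lemma theta_neg (hτ : 0 < τ.im) (v : ℂ) : theta (-v) τ = -theta v τ := by
  have hq := norm_nome_lt_one hτ
  rw [theta_eq_qProd hτ, theta_eq_qProd hτ, qProd_eq_mul hq (exp (2 * _ * _ * v)),
    qProd_eq_mul hq (exp (2 * _ * _ * -v))]
  simp only [mul_neg, neg_neg]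
  have : exp ((Real.pi : ℂ) * I * v) * (1 - exp (-(2 * (Real.pi : ℂ) * I * v))) =
      -(exp (-((Real.pi : ℂ) * I * v)) * (1 - exp (2 * (Real.pi : ℂ) * I * v))) := by
    simp only [mul_sub, ← exp_add, mul_one]
    ring_nf
  linear_combination (I * exp ((Real.pi : ℂ) * I * τ / 4) * qProd (nome τ) (nome τ) *
    qProd (nome τ) (nome τ * exp (2 * (Real.pi : ℂ) * I * v)) *
    qProd (nome τ) (nome τ * exp (-(2 * (Real.pi : ℂ) * I * v)))) * this

lemma theta_add_tau (hτ : 0 < τ.im) (v : ℂ) :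
    theta (v + τ) τ =
      -exp (-((Real.pi : ℂ) * I * τ)) * exp (-(2 * (Real.pi : ℂ) * I * v)) * theta v τ := by
  have hq := norm_nome_lt_one hτ
  have e1 : exp (2 * (Real.pi : ℂ) * I * (v + τ)) =
      nome τ * exp (2 * (Real.pi : ℂ) * I * v) := by
    rw [nome, ← exp_add]; ring_nf
  have e2 : nome τ * exp (-(2 * (Real.pi : ℂ) * I * (v + τ))) =
      exp (-(2 * (Real.pi : ℂ) * I * v)) := by
    rw [nome, ← exp_add]; ring_nf
  have e3 : exp (-((Real.pi : ℂ) * I * (v + τ))) =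
      exp (-((Real.pi : ℂ) * I * τ)) * exp (-((Real.pi : ℂ) * I * v)) := by
    rw [← exp_add]; ring_nf
  rw [theta_eq_qProd hτ, theta_eq_qProd hτ, e1, e2, e3,
    qProd_eq_mul hq (exp (2 * _ * _ * v)), qProd_eq_mul hq (exp (-(2 * _ * _ * v)))]
  have : exp (-(2 * (Real.pi : ℂ) * I * v)) * exp (2 * (Real.pi : ℂ) * I * v) = 1 := by
    rw [← exp_add]; simp
  generalize qProd (nome τ) (nome τ * exp (2 * (Real.pi : ℂ) * I * v)) = A
  generalize qProd (nome τ) (nome τ * exp (-(2 * (Real.pi : ℂ) * I * v))) = B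
  linear_combination (-I * exp ((Real.pi : ℂ) * I * τ / 4) * exp (-((Real.pi : ℂ) * I * τ)) *
    exp (-((Real.pi : ℂ) * I * v)) * qProd (nome τ) (nome τ) * A * B) * this

lemma theta_zero (hτ : 0 < τ.im) : theta 0 τ = 0 := by
  have h := theta_neg hτ 0
  rw [neg_zero] at h
  linear_combination h / 2

lemma exists_eq_of_theta_eq_zero (hτ : 0 < τ.im) {v : ℂ} (hv : theta v τ = 0) :
    ∃ a b : ℤ, v = a + b * τ := by
  have hq := norm_nome_lt_one hτ
  have hpi : (2 * (Real.pi : ℂ) * I) ≠ 0 := two_pi_I_ne_zero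
  rw [theta_eq_qProd hτ] at hv
  have hcases : qProd (nome τ) (exp (2 * (Real.pi : ℂ) * I * v)) = 0 ∨
      qProd (nome τ) (nome τ * exp (-(2 * (Real.pi : ℂ) * I * v))) = 0 := by
    simpa [I_ne_zero, exp_ne_zero, qProd_nome_ne_zero hτ] using hv
  rcases hcases with h | h
  · have : ∃ k : ℕ, nome τ ^ k * exp (2 * (Real.pi : ℂ) * I * v) = 1 := by
      by_contra! hc
      exact qProd_ne_zero hq hc h
    obtain ⟨k, hk⟩ := this
    rw [nome, ← exp_nat_mul, ← exp_add, exp_eq_one_iff] at hk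
    obtain ⟨n, hn⟩ := hk
    refine ⟨n, -k, mul_left_cancel₀ hpi ?_⟩
    push_cast
    linear_combination hn
  · have : ∃ k : ℕ, nome τ ^ k * (nome τ * exp (-(2 * (Real.pi : ℂ) * I * v))) = 1 := by
      by_contra! hc
      exact qProd_ne_zero hq hc h
    obtain ⟨k, hk⟩ := this
    rw [nome, ← exp_nat_mul, ← exp_add, ← exp_add, exp_eq_one_iff] at hk
    obtain ⟨n, hn⟩ := hk
    refine ⟨-n, k + 1, mul_left_cancel₀ hpi ?_⟩
    push_cast
    linear_combination -hn

/-- Quasi-periodicity of `theta` under the lattice `ℤ + ℤτ`. -/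
lemma theta_add_lattice (hτ : 0 < τ.im) (a b : ℤ) :
    ∃ c : ℂ, c ≠ 0 ∧ ∀ z, theta (z + (a + b * τ)) τ =
      c * exp (-(2 * (Real.pi : ℂ) * I * b * z)) * theta z τ := by
  have h1 : ∀ z, theta (z + a) τ = (-1) ^ a * theta z τ := by
    induction a using Int.induction_on with
    | zero => simp
    | succ n ih =>
      intro z
      rw [zpow_add_one₀ (by norm_num), show z + ((n + 1 : ℤ) : ℂ) = z + (n : ℤ) + 1 by
        push_cast; ring, theta_add_one hτ, ih]
      ring
    | pred n ih =>
      intro z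
      have h := theta_add_one hτ (z + ((-n - 1 : ℤ) : ℂ))
      rw [show z + ((-n - 1 : ℤ) : ℂ) + 1 = z + ((-n : ℤ) : ℂ) by push_cast; ring, ih] at h
      rw [zpow_sub_one₀ (by norm_num)]
      linear_combination h
  have h2 : ∃ c : ℂ, c ≠ 0 ∧ ∀ z, theta (z + b * τ) τ =
      c * exp (-(2 * (Real.pi : ℂ) * I * b * z)) * theta z τ := by
    clear h1
    induction b using Int.induction_on with
    | zero => exact ⟨1, one_ne_zero, by simp⟩
    | succ n ih =>
      obtain ⟨c, hc, h⟩ := ih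
      refine ⟨-exp (-((Real.pi : ℂ) * I * τ)) * exp (-(2 * (Real.pi : ℂ) * I * (n * τ))) * c,
        by simp [hc, exp_ne_zero], fun z => ?_⟩
      rw [show z + ((n + 1 : ℤ) : ℂ) * τ = z + (n : ℤ) * τ + τ by push_cast; ring,
        theta_add_tau hτ, h]
      have e : exp (-(2 * (Real.pi : ℂ) * I * (z + (n : ℤ) * τ))) *
          exp (-(2 * (Real.pi : ℂ) * I * (n : ℤ) * z)) =
          exp (-(2 * (Real.pi : ℂ) * I * (n * τ))) *
            exp (-(2 * (Real.pi : ℂ) * I * (n + 1 : ℤ) * z)) := by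
        rw [← exp_add, ← exp_add]; push_cast; ring_nf
      linear_combination -exp (-((Real.pi : ℂ) * I * τ)) * c * theta z τ * e
    | pred n ih =>
      obtain ⟨c, hc, h⟩ := ih
      refine ⟨-exp ((Real.pi : ℂ) * I * τ) * exp (-(2 * (Real.pi : ℂ) * I * ((n + 1) * τ))) * c,
        by simp [hc, exp_ne_zero], fun z => ?_⟩
      have h' := theta_add_tau hτ (z + ((-n - 1 : ℤ) : ℂ) * τ)
      rw [show z + ((-n - 1 : ℤ) : ℂ) * τ + τ = z + ((-n : ℤ) : ℂ) * τ by push_cast; ring,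
        h] at h'
      have e0 : exp ((Real.pi : ℂ) * I * τ) * exp (-((Real.pi : ℂ) * I * τ)) = 1 := by
        rw [← exp_add]; simp
      have e1 : exp (2 * (Real.pi : ℂ) * I * (z + ((-n - 1 : ℤ) : ℂ) * τ)) *
          exp (-(2 * (Real.pi : ℂ) * I * (z + ((-n - 1 : ℤ) : ℂ) * τ))) = 1 := by
        rw [← exp_add]; simp
      have e : exp (2 * (Real.pi : ℂ) * I * (z + ((-n - 1 : ℤ) : ℂ) * τ)) *
          exp (-(2 * (Real.pi : ℂ) * I * (-n : ℤ) * z)) =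
          exp (-(2 * (Real.pi : ℂ) * I * ((n + 1) * τ))) *
            exp (-(2 * (Real.pi : ℂ) * I * (-n - 1 : ℤ) * z)) := by
        rw [← exp_add, ← exp_add]; push_cast; ring_nf
      generalize theta (z + ((-n - 1 : ℤ) : ℂ) * τ) τ = T at h' ⊢
      generalize exp (2 * (Real.pi : ℂ) * I * (z + ((-n - 1 : ℤ) : ℂ) * τ)) = E at *
      generalize exp (-(2 * (Real.pi : ℂ) * I * (z + ((-n - 1 : ℤ) : ℂ) * τ))) = E' at *
      linear_combination exp ((Real.pi : ℂ) * I * τ) * E * h' - T * E' * E * e0 - T * e1 -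
        exp ((Real.pi : ℂ) * I * τ) * c * theta z τ * e
  obtain ⟨c, hc, h2⟩ := h2
  refine ⟨c * (-1) ^ a * exp (-(2 * (Real.pi : ℂ) * I * b * a)),
    by simp [hc, exp_ne_zero, zpow_ne_zero], fun z => ?_⟩
  rw [← add_assoc, h2, h1, mul_add, neg_add, exp_add]
  ring

lemma theta_add_lattice_eq_zero_iff (hτ : 0 < τ.im) (a b : ℤ) (z : ℂ) :
    theta (z + (a + b * τ)) τ = 0 ↔ theta z τ = 0 := by
  obtain ⟨c, hc, h⟩ := theta_add_lattice hτ a b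
  simp [h, hc, exp_ne_zero]

lemma theta_div_add_lattice (hτ : 0 < τ.im) (a b : ℤ) (u w : ℂ) :
    theta (u + (a + b * τ)) τ / theta (w + (a + b * τ)) τ =
      exp (2 * (Real.pi : ℂ) * I * b * (w - u)) * (theta u τ / theta w τ) := by
  obtain ⟨c, hc, h⟩ := theta_add_lattice hτ a b
  rw [h, h, show 2 * (Real.pi : ℂ) * I * b * (w - u) =
    -(2 * (Real.pi : ℂ) * I * b * u) - -(2 * (Real.pi : ℂ) * I * b * w) by ring, exp_sub,
    mul_div_mul_comm, mul_div_mul_left _ _ hc]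

lemma theta_eq_zero_iff (hτ : 0 < τ.im) (z : ℂ) :
    theta z τ = 0 ↔ ∃ a b : ℤ, z = a + b * τ := by
  refine ⟨exists_eq_of_theta_eq_zero hτ, ?_⟩
  rintro ⟨a, b, rfl⟩
  rw [← zero_add ((a : ℂ) + b * τ), theta_add_lattice_eq_zero_iff hτ, theta_zero hτ]

lemma deriv_theta_zero (hτ : 0 < τ.im) :
    deriv (fun v => theta v τ) 0 =
      2 * Real.pi * exp ((Real.pi : ℂ) * I * τ / 4) * qProd (nome τ) (nome τ) ^ 3 := by
  have hq := norm_nome_lt_one hτ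
  have h := differentiable_qProd hq
  let U : ℂ → ℂ := fun v => I * exp ((Real.pi : ℂ) * I * τ / 4) *
    exp (-((Real.pi : ℂ) * I * v)) * (qProd (nome τ) (nome τ) *
    qProd (nome τ) (nome τ * exp (2 * (Real.pi : ℂ) * I * v)) *
    qProd (nome τ) (nome τ * exp (-(2 * (Real.pi : ℂ) * I * v))))
  have hU : Differentiable ℂ U := by
    have h1 : Differentiable ℂ fun v : ℂ =>
        qProd (nome τ) (nome τ * exp (2 * (Real.pi : ℂ) * I * v)) := h.comp (by fun_prop)
    have h2 : Differentiable ℂ fun v : ℂ =>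
        qProd (nome τ) (nome τ * exp (-(2 * (Real.pi : ℂ) * I * v))) := h.comp (by fun_prop)
    fun_prop
  have e : (fun v => theta v τ) = fun v => (1 - exp (2 * (Real.pi : ℂ) * I * v)) * U v := by
    funext v
    rw [theta_eq_qProd hτ, qProd_eq_mul hq (exp (2 * _ * _ * v))]
    ring
  have h3 : HasDerivAt (fun v : ℂ => 1 - exp (2 * (Real.pi : ℂ) * I * v))
      (-(exp (2 * (Real.pi : ℂ) * I * 0) * (2 * (Real.pi : ℂ) * I * 1))) 0 :=
    ((((hasDerivAt_id (0 : ℂ)).const_mul _).cexp).const_sub 1)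
  rw [e, (h3.fun_mul (hU 0).hasDerivAt).deriv]
  simp only [mul_zero, exp_zero, sub_self, zero_mul, add_zero, U, neg_zero, mul_one]
  linear_combination -2 * (Real.pi : ℂ) * exp ((Real.pi : ℂ) * I * τ / 4) *
    qProd (nome τ) (nome τ) ^ 3 * I_sq

lemma deriv_theta_zero_ne_zero (hτ : 0 < τ.im) : deriv (fun v => theta v τ) 0 ≠ 0 := by
  rw [deriv_theta_zero hτ]
  have := Real.pi_ne_zero
  simp [exp_ne_zero, qProd_nome_ne_zero hτ, this]

lemma Gfun_mul_deriv_theta (hτ : 0 < τ.im) (v : ℂ) :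
    Gfun v τ * deriv (fun v => theta v τ) 0 = -(2 * Real.pi * I) * theta v τ := by
  have hq := norm_nome_lt_one hτ
  have h0 := qProd_nome_ne_zero hτ
  have h1 := multipliable_qProd hq (nome τ)
  have h2 := multipliable_qProd hq (exp (2 * (Real.pi : ℂ) * I * v))
  have h3 := multipliable_qProd hq (nome τ * exp (-(2 * (Real.pi : ℂ) * I * v)))
  have hG : Gfun v τ = exp (-((Real.pi : ℂ) * I * v)) *
      (qProd (nome τ) (exp (2 * (Real.pi : ℂ) * I * v)) *
        qProd (nome τ) (nome τ * exp (-(2 * (Real.pi : ℂ) * I * v))) /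
        (qProd (nome τ) (nome τ) * qProd (nome τ) (nome τ))) := by
    rw [qProd, qProd, qProd] at *
    rw [← h2.tprod_mul h3, ← h1.tprod_mul h1, ← (h2.mul h3).tprod_div₀ (h1.mul h1)
      (by rw [h1.tprod_mul h1]; exact mul_ne_zero h0 h0), Gfun]
    congr 2
    funext k
    simp only [nome, exp_neg]
    ring
  rw [hG, deriv_theta_zero hτ, theta_eq_qProd hτ]
  field_simp
  rw [I_sq]
  ring

end Theta

section EntireFunctions

open Filter Topology

lemma eventuallyEq_nhdsNE_comp_add_const {E : Type*} {f g : ℂ → E} {z t : ℂ}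
    (h : f =ᶠ[𝓝[≠] (z + t)] g) : (fun w => f (w + t)) =ᶠ[𝓝[≠] z] fun w => g (w + t) := by
  have ht : Tendsto (fun w : ℂ => w + t) (𝓝[≠] z) (𝓝[≠] (z + t)) :=
    (show ContinuousAt (fun w : ℂ => w + t) z by fun_prop).tendsto.inf
      (tendsto_principal_principal.mpr fun w hw => by simpa using hw)
  exact ht.eventually h

lemma eq_of_eventuallyEq_nhdsNE {f g : ℂ → ℂ} {z : ℂ} (hf : ContinuousAt f z)
    (hg : ContinuousAt g z) (h : f =ᶠ[𝓝[≠] z] g) : f z = g z :=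
  tendsto_nhds_unique (hf.tendsto.mono_left nhdsWithin_le_nhds)
    ((hg.tendsto.mono_left nhdsWithin_le_nhds).congr' h.symm)

/-- A function all of whose singularities are removable agrees with an entire function on
punctured neighbourhoods. -/
lemma exists_entire_of_removable {H : ℂ → ℂ}
    (hH : ∀ z, ∃ A : ℂ → ℂ, AnalyticAt ℂ A z ∧ H =ᶠ[𝓝[≠] z] A) :
    ∃ h : ℂ → ℂ, Differentiable ℂ h ∧ ∀ z, H =ᶠ[𝓝[≠] z] h := by
  choose A hA hHA using hH
  have key : ∀ z, (fun w => A w w) =ᶠ[𝓝 z] A z := by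
    intro z
    have h1 : ∀ᶠ w in 𝓝[≠] z, A w w = A z w := by
      filter_upwards [eventually_eventually_nhdsWithin.2 (hHA z), self_mem_nhdsWithin,
        nhdsWithin_le_nhds (hA z).eventually_analyticAt] with w hw hne han
      have hw' : H =ᶠ[𝓝[≠] w] A z := by
        have : 𝓝[{z}ᶜ] w = 𝓝 w := isOpen_compl_singleton.nhdsWithin_eq hne
        rw [this] at hw
        exact nhdsWithin_le_nhds hw
      exact eq_of_eventuallyEq_nhdsNE (hA w).continuousAt han.continuousAt
        ((hHA w).symm.trans hw')
    rw [eventually_nhdsWithin_iff] at h1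
    filter_upwards [h1] with w hw
    rcases eq_or_ne w z with rfl | hne
    · rfl
    · exact hw hne
  exact ⟨fun w => A w w, fun z => ((hA z).congr (key z).symm).differentiableAt,
    fun z => (hHA z).trans (nhdsWithin_le_nhds (key z).symm)⟩

/-- An entire function, periodic under `1` and additively quasi-periodic under `τ`, is periodic
under `τ`. -/
lemma eq_zero_of_entire_of_quasiperiodic {τ C : ℂ} (hτ : 0 < τ.im) {h : ℂ → ℂ}
    (hh : Differentiable ℂ h) (h1 : ∀ z, h (z + 1) = h z) (h2 : ∀ z, h (z + τ) = h z + C) :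
    C = 0 := by
  have hd : Differentiable ℂ (deriv h) := hh.deriv
  have p1 : Function.Periodic (deriv h) 1 := fun z => by
    rw [← deriv_comp_add_const]
    simp only [h1]
  have p2 : Function.Periodic (deriv h) τ := fun z => by
    rw [← deriv_comp_add_const]
    simp only [h2, deriv_add_const]
  have hb : Bornology.IsBounded (Set.range (deriv h)) := by
    refine ((isCompact_closedBall (0 : ℂ) (1 + ‖τ‖)).image hd.continuous).isBounded.subset ?_
    rintro _ ⟨z, rfl⟩
    set y : ℝ := z.im / τ.im with hy
    set x : ℝ := (z - y * τ).re with hx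
    have hz : z = x + y * τ := by
      apply Complex.ext
      · simp [hx]
      · simp [hy, hτ.ne']
    refine ⟨z - ⌊y⌋ * τ - ⌊x⌋, ?_, ?_⟩
    · have : z - ⌊y⌋ * τ - ⌊x⌋ = (Int.fract x : ℝ) + (Int.fract y : ℝ) * τ := by
        nth_rewrite 1 [hz]
        simp only [Int.fract]
        push_cast
        ring
      rw [mem_closedBall_zero_iff, this]
      refine (norm_add_le _ _).trans (add_le_add ?_ ?_)
      · rw [Complex.norm_real, Real.norm_of_nonneg (Int.fract_nonneg _)]
        exact (Int.fract_lt_one _).le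
      · rw [norm_mul, Complex.norm_real, Real.norm_of_nonneg (Int.fract_nonneg _)]
        exact mul_le_of_le_one_left (norm_nonneg _) (Int.fract_lt_one _).le
    · have e1 := p1.sub_int_mul_eq (x := z - ⌊y⌋ * τ) ⌊x⌋
      rw [mul_one] at e1
      rw [e1, p2.sub_int_mul_eq]
  have hconst : ∀ z, deriv h z = deriv h 0 := fun z => hd.apply_eq_apply_of_bounded hb z 0
  have hlin : ∀ z, h z = h 0 + deriv h 0 * z := by
    have hD : Differentiable ℂ fun z => h z - deriv h 0 * z := by fun_prop
    have hD' : ∀ z, deriv (fun z => h z - deriv h 0 * z) z = 0 := fun z => by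
      have := (hh z).hasDerivAt.fun_sub ((hasDerivAt_id z).const_mul (deriv h 0))
      simp only [id] at this
      rw [this.deriv, hconst z]
      ring
    intro z
    have := is_const_of_deriv_eq_zero hD hD' z 0
    simp only [mul_zero, sub_zero] at this
    linear_combination this
  have a1 := h1 0
  have a2 := h2 0
  rw [zero_add, hlin 1, mul_one] at a1
  rw [zero_add, hlin τ] at a2
  linear_combination τ * a1 - a2

end EntireFunctions

section ThetaZeta

open Filter Topology

variable {τ : ℂ}

/-- The logarithmic derivative of `theta`, a substitute for the Weierstrass zeta function. -/
noncomputable def thetaZeta (τ : ℂ) : ℂ → ℂ := logDeriv fun z => theta z τ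

lemma analyticAt_theta (hτ : 0 < τ.im) (z : ℂ) : AnalyticAt ℂ (fun z => theta z τ) z :=
  (differentiable_theta hτ).analyticAt z

lemma analyticAt_thetaZeta (hτ : 0 < τ.im) {z : ℂ} (hz : theta z τ ≠ 0) :
    AnalyticAt ℂ (thetaZeta τ) z :=
  (analyticAt_theta hτ z).deriv.div (analyticAt_theta hτ z) hz

lemma analyticAt_iteratedDeriv_thetaZeta (hτ : 0 < τ.im) (k : ℕ) {z : ℂ} (hz : theta z τ ≠ 0) :
    AnalyticAt ℂ (iteratedDeriv k (thetaZeta τ)) z := by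
  rw [iteratedDeriv_eq_iterate]
  exact (analyticAt_thetaZeta hτ hz).iterated_deriv k

lemma eventually_theta_ne_zero (hτ : 0 < τ.im) (z : ℂ) : ∀ᶠ w in 𝓝[≠] z, theta w τ ≠ 0 := by
  rcases (analyticAt_theta hτ z).eventually_eq_zero_or_eventually_ne_zero with h | h
  · have h0 := AnalyticOnNhd.eq_of_eventuallyEq (f := fun z => theta z τ) (g := fun _ => 0)
      (fun w _ => analyticAt_theta hτ w) (fun w _ => analyticAt_const) h
    have := deriv_theta_zero_ne_zero hτ
    rw [h0] at this
    simp at this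
  · exact h

lemma thetaZeta_add_lattice (hτ : 0 < τ.im) (a b : ℤ) {z : ℂ} (hz : theta z τ ≠ 0) :
    thetaZeta τ (z + (a + b * τ)) = -(2 * Real.pi * I * b) + thetaZeta τ z := by
  obtain ⟨c, hc, h⟩ := theta_add_lattice hτ a b
  have hd := (differentiable_theta hτ z).hasDerivAt
  have he : HasDerivAt (fun z => c * exp (-(2 * (Real.pi : ℂ) * I * b * z)))
      (c * (exp (-(2 * (Real.pi : ℂ) * I * b * z)) * -(2 * (Real.pi : ℂ) * I * b * 1))) z :=
    (((hasDerivAt_id z).const_mul _).neg.cexp).const_mul c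
  rw [thetaZeta, logDeriv_apply, logDeriv_apply, ← deriv_comp_add_const]
  simp only [h]
  rw [(he.fun_mul hd).deriv]
  have := exp_ne_zero (-(2 * (Real.pi : ℂ) * I * b * z))
  field_simp

lemma iteratedDeriv_thetaZeta_add_lattice (hτ : 0 < τ.im) (a b : ℤ) (k : ℕ) {z : ℂ}
    (hz : theta z τ ≠ 0) :
    iteratedDeriv k (thetaZeta τ) (z + (a + b * τ)) =
      (if k = 0 then -(2 * Real.pi * I * b) else 0) + iteratedDeriv k (thetaZeta τ) z := by
  rcases Nat.eq_zero_or_pos k with rfl | hk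
  · simpa using thetaZeta_add_lattice hτ a b hz
  · have hev : (fun w => thetaZeta τ (w + (a + b * τ))) =ᶠ[𝓝 z]
        fun w => -(2 * Real.pi * I * b) + thetaZeta τ w := by
      filter_upwards [(analyticAt_theta hτ z).continuousAt.eventually_ne hz] with w hw
      exact thetaZeta_add_lattice hτ a b hw
    have h := hev.iteratedDeriv_eq k
    rw [iteratedDeriv_comp_add_const, iteratedDeriv_const_add hk] at h
    simpa [hk.ne'] using h

lemma exists_theta_eq_mul (hτ : 0 < τ.im) : ∃ T : ℂ → ℂ, Differentiable ℂ T ∧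
    T 0 = deriv (fun v => theta v τ) 0 ∧ ∀ z, theta z τ = z * T z := by
  refine ⟨dslope (fun v => theta v τ) 0, ?_, dslope_same _ _, fun z => ?_⟩
  · rw [← differentiableOn_univ, Complex.differentiableOn_dslope univ_mem]
    exact (differentiable_theta hτ).differentiableOn
  · simpa [theta_zero hτ] using (sub_smul_dslope (fun z => theta z τ) 0 z).symm

lemma iteratedDeriv_thetaZeta_eventuallyEq (hτ : 0 < τ.im) (k : ℕ) :
    ∃ a : ℂ → ℂ, AnalyticAt ℂ a 0 ∧ iteratedDeriv k (thetaZeta τ) =ᶠ[𝓝[≠] 0]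
      fun z => (-1) ^ k * k.factorial / z ^ (k + 1) + a z := by
  induction k with
  | zero =>
    obtain ⟨T, hT, hT0', hθT⟩ := exists_theta_eq_mul hτ
    have hTan := hT.analyticAt 0
    have hT0 : T 0 ≠ 0 := hT0' ▸ deriv_theta_zero_ne_zero hτ
    have hθ : (fun z => theta z τ) = fun z => z * T z := funext hθT
    refine ⟨logDeriv T, hTan.deriv.div hTan hT0, ?_⟩
    filter_upwards [self_mem_nhdsWithin,
      nhdsWithin_le_nhds (hTan.continuousAt.eventually_ne hT0)] with z hz hTz
    rw [iteratedDeriv_zero, thetaZeta, hθ, logDeriv_mul (f := fun z => z) z hz hTz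
      differentiableAt_fun_id (hT z), logDeriv_id']
    simp
  | succ k ih =>
    obtain ⟨a, ha, h⟩ := ih
    refine ⟨deriv a, ha.deriv, ?_⟩
    rw [iteratedDeriv_succ]
    refine h.nhdsNE_deriv.trans ?_
    filter_upwards [self_mem_nhdsWithin, nhdsWithin_le_nhds ha.eventually_analyticAt]
      with z hz haz
    have hz : z ≠ 0 := hz
    have h1 := ((hasDerivAt_pow (k + 1) z).fun_inv (pow_ne_zero _ hz)).const_mul
      ((-1) ^ k * (k.factorial : ℂ))
    simp only [div_eq_mul_inv]
    rw [(h1.fun_add haz.differentiableAt.hasDerivAt).deriv, Nat.factorial_succ]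
    push_cast
    field_simp
    ring

/-- A pole of order at most `n + 1` has a principal part spanned by derivatives of `thetaZeta`. -/
lemma exists_principalPart (hτ : 0 < τ.im) (s : ℂ) (n : ℕ) {f g : ℂ → ℂ} (hg : AnalyticAt ℂ g s)
    (hf : f =ᶠ[𝓝[≠] s] fun z => g z / (z - s) ^ (n + 1)) :
    ∃ c : ℕ → ℂ, (n = 0 → c 0 = g s) ∧ ∃ A : ℂ → ℂ, AnalyticAt ℂ A s ∧ f =ᶠ[𝓝[≠] s]
      fun z => ∑ k ∈ Finset.range (n + 1), c k * iteratedDeriv k (thetaZeta τ) (z - s) + A z := by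
  have step : ∀ (n : ℕ) {g : ℂ → ℂ}, AnalyticAt ℂ g s → ∃ c : ℂ, (n = 0 → c = g s) ∧
      ∃ g₁ : ℂ → ℂ, AnalyticAt ℂ g₁ s ∧ (fun z => g z / (z - s) ^ (n + 1)) =ᶠ[𝓝[≠] s]
        fun z => c * iteratedDeriv n (thetaZeta τ) (z - s) + g₁ z / (z - s) ^ n := by
    intro n g hg
    obtain ⟨a, ha, h⟩ := iteratedDeriv_thetaZeta_eventuallyEq hτ n
    have hγ : ((-1) ^ n * n.factorial : ℂ) ≠ 0 :=
      mul_ne_zero (by simp) (by exact_mod_cast n.factorial_ne_zero)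
    have hd : AnalyticAt ℂ (dslope g s) s := by
      obtain ⟨p, hp⟩ := hg
      exact ⟨_, hp.has_fpower_series_dslope_fslope⟩
    have has : AnalyticAt ℂ (fun z => a (z - s)) s :=
      AnalyticAt.fun_comp (g := a) (by simpa using ha) (by fun_prop)
    refine ⟨g s / ((-1) ^ n * n.factorial), by rintro rfl; simp,
      fun z => dslope g s z - g s / ((-1) ^ n * n.factorial) * (a (z - s) * (z - s) ^ n),
      hd.sub (analyticAt_const.mul (has.mul (by fun_prop))), ?_⟩
    generalize ((-1) ^ n * n.factorial : ℂ) = γ at *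
    have h' := eventuallyEq_nhdsNE_comp_add_const (z := s) (t := -s) (by simpa using h)
    filter_upwards [h', self_mem_nhdsWithin] with z hz hne
    have hne : z - s ≠ 0 := sub_ne_zero.mpr hne
    have hgz := sub_smul_dslope g s z
    rw [smul_eq_mul] at hgz
    simp only [← sub_eq_add_neg] at hz
    rw [hz, eq_add_of_sub_eq hgz.symm]
    field_simp
    ring
  induction n generalizing f g with
  | zero =>
    obtain ⟨c, hc, g₁, hg₁, h⟩ := step 0 hg
    exact ⟨fun _ => c, fun _ => hc rfl, g₁, hg₁, hf.trans (h.trans (by simp))⟩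
  | succ n ih =>
    obtain ⟨c, -, g₁, hg₁, h⟩ := step (n + 1) hg
    obtain ⟨c', -, A, hA, h'⟩ := ih hg₁ (EventuallyEq.refl _ _)
    refine ⟨fun k => if k < n + 1 then c' k else c, by simp, A, hA, ?_⟩
    filter_upwards [hf, h, h'] with z h1 h2 h3
    rw [h1, h2, h3, Finset.sum_range_succ _ (n + 1)]
    have : ∀ k ∈ Finset.range (n + 1), (if k < n + 1 then c' k else c) *
        iteratedDeriv k (thetaZeta τ) (z - s) =
        c' k * iteratedDeriv k (thetaZeta τ) (z - s) := fun k hk => by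
      rw [if_pos (Finset.mem_range.mp hk)]
    rw [Finset.sum_congr rfl this, if_neg (lt_irrefl _)]
    ring

/-- The sum of the residues of an elliptic function vanishes. -/
theorem sum_residue_eq_zero (hτ : 0 < τ.im) {ι : Type*} [Fintype ι] {s : ι → ℂ}
    (hs : ∀ i j, i ≠ j → theta (s i - s j) τ ≠ 0) {n : ι → ℕ} {c : ι → ℕ → ℂ} {f : ℂ → ℂ}
    (hper : ∀ (a b : ℤ) (z : ℂ), f (z + (a + b * τ)) = f z)
    (hf : ∀ z, (∀ i, theta (z - s i) τ ≠ 0) → AnalyticAt ℂ f z)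
    (hpole : ∀ i, ∃ A : ℂ → ℂ, AnalyticAt ℂ A (s i) ∧ f =ᶠ[𝓝[≠] s i] fun z =>
      ∑ k ∈ Finset.range (n i + 1), c i k * iteratedDeriv k (thetaZeta τ) (z - s i) + A z) :
    ∑ i, c i 0 = 0 := by
  classical
  set P : ι → ℂ → ℂ := fun i z =>
    ∑ k ∈ Finset.range (n i + 1), c i k * iteratedDeriv k (thetaZeta τ) (z - s i) with hP
  have hPan : ∀ i z, theta (z - s i) τ ≠ 0 → AnalyticAt ℂ (P i) z := fun i z hz =>
    Finset.analyticAt_fun_sum _ fun k _ => analyticAt_const.mul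
      ((analyticAt_iteratedDeriv_thetaZeta hτ k hz).fun_comp (f := fun z => z - s i) (by fun_prop))
  have hPper : ∀ i (a b : ℤ) z, theta (z - s i) τ ≠ 0 →
      P i (z + (a + b * τ)) = P i z - 2 * Real.pi * I * b * c i 0 := by
    intro i a b z hz
    simp only [hP, add_sub_right_comm z _ (s i), iteratedDeriv_thetaZeta_add_lattice hτ a b _ hz,
      mul_add, Finset.sum_add_distrib]
    rw [Finset.sum_eq_single 0 (by simp +contextual) (by simp)]
    simp
    ring
  set H : ℂ → ℂ := fun z => f z - ∑ i, P i z with hH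
  set C : ℂ := 2 * Real.pi * I * ∑ i, c i 0 with hC
  have hHper : ∀ (a b : ℤ) z, (∀ i, theta (z - s i) τ ≠ 0) →
      H (z + (a + b * τ)) = H z + b * C := by
    intro a b z hz
    simp only [hH, hC, hper]
    rw [Finset.sum_congr rfl fun i _ => hPper i a b z (hz i), Finset.sum_sub_distrib,
      ← Finset.mul_sum]
    ring
  have hreg : ∀ z, ∀ᶠ w in 𝓝[≠] z, ∀ i, theta (w - s i) τ ≠ 0 := by
    intro z
    rw [eventually_all]
    intro i
    have ht : Tendsto (fun w : ℂ => w - s i) (𝓝[≠] z) (𝓝[≠] (z - s i)) :=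
      (show ContinuousAt (fun w : ℂ => w - s i) z by fun_prop).tendsto.inf
        (tendsto_principal_principal.mpr fun w hw => by simpa using hw)
    exact ht.eventually (eventually_theta_ne_zero hτ (z - s i))
  have hHs : ∀ i, ∃ A : ℂ → ℂ, AnalyticAt ℂ A (s i) ∧ H =ᶠ[𝓝[≠] s i] A := by
    intro i
    obtain ⟨A, hA, h⟩ := hpole i
    refine ⟨fun z => A z - ∑ j ∈ Finset.univ.erase i, P j z, hA.sub
      (Finset.analyticAt_fun_sum _ fun j hj => hPan j _ (hs i j (Finset.ne_of_mem_erase hj).symm)),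
      ?_⟩
    filter_upwards [h] with z hz
    simp only [hH]
    rw [hz, ← Finset.add_sum_erase _ _ (Finset.mem_univ i)]
    ring
  have hHall : ∀ z, ∃ A : ℂ → ℂ, AnalyticAt ℂ A z ∧ H =ᶠ[𝓝[≠] z] A := by
    intro z
    by_cases hz : ∀ i, theta (z - s i) τ ≠ 0
    · exact ⟨H, (hf z hz).sub (Finset.analyticAt_fun_sum _ fun i _ => hPan i z (hz i)),
        EventuallyEq.refl _ _⟩
    · push Not at hz
      obtain ⟨i, hi⟩ := hz
      obtain ⟨a, b, hab⟩ := exists_eq_of_theta_eq_zero hτ hi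
      obtain ⟨A, hA, h⟩ := hHs i
      have hsi : z + -(a + b * τ) = s i := by linear_combination hab
      refine ⟨fun w => A (w + -(a + b * τ)) + b * C,
        (AnalyticAt.fun_comp (g := A) (by rwa [hsi]) (by fun_prop)).add analyticAt_const, ?_⟩
      have h' := eventuallyEq_nhdsNE_comp_add_const (f := H) (g := A) (z := z)
        (t := -(a + b * τ)) (by rwa [hsi])
      have hr : ∀ᶠ w in 𝓝[≠] z, ∀ j, theta (w + -(a + b * τ) - s j) τ ≠ 0 := by
        filter_upwards [hreg z] with w hw j hj
        apply hw j
        rw [← theta_add_lattice_eq_zero_iff hτ a b] at hj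
        convert hj using 2
        ring
      filter_upwards [h', hr] with w hw hwr
      rw [← hw, ← hHper a b _ hwr]
      congr 1
      ring
  obtain ⟨h, hh, hHh⟩ := exists_entire_of_removable hHall
  have hhper : ∀ (a b : ℤ) z, h (z + (a + b * τ)) = h z + b * C := by
    intro a b z
    have hc := hh.continuous
    refine eq_of_eventuallyEq_nhdsNE (f := fun w => h (w + (a + b * τ)))
      (g := fun w => h w + b * C) (by fun_prop) (by fun_prop) ?_
    filter_upwards [hreg z, hHh z, eventuallyEq_nhdsNE_comp_add_const (hHh (z + (a + b * τ)))]
      with w h1 h2 h3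
    rw [← h2, ← h3, hHper a b w h1]
  have hC0 := eq_zero_of_entire_of_quasiperiodic hτ hh (C := C)
    (fun z => by simpa using hhper 1 0 z) (fun z => by simpa using hhper 0 1 z)
  exact (mul_eq_zero.mp hC0).resolve_left two_pi_I_ne_zero

/-- The circle integral of a function with a given principal part at `0`. -/
lemma eventually_circleIntegral_eq (hτ : 0 < τ.im) {n : ℕ} {c : ℕ → ℂ} {f A : ℂ → ℂ}
    (hA : AnalyticAt ℂ A 0) (hf : f =ᶠ[𝓝[≠] 0] fun z =>
      ∑ k ∈ Finset.range (n + 1), c k * iteratedDeriv k (thetaZeta τ) z + A z) :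
    ∀ᶠ ε in 𝓝[>] (0 : ℝ), (∮ z in C(0, ε), f z) = 2 * Real.pi * I * c 0 := by
  obtain ⟨a, ha, h0⟩ := iteratedDeriv_thetaZeta_eventuallyEq hτ 0
  have hall := (hf.and (h0.and (eventually_theta_ne_zero hτ 0))).and
    (nhdsWithin_le_nhds (hA.eventually_analyticAt.and ha.eventually_analyticAt))
  rw [eventually_nhdsWithin_iff, Metric.eventually_nhds_iff_ball] at hall
  obtain ⟨δ, hδ, hall⟩ := hall
  have hAa : AnalyticAt ℂ A 0 ∧ AnalyticAt ℂ a 0 := ⟨hA, ha⟩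
  filter_upwards [Ioo_mem_nhdsGT hδ] with ε ⟨hε0, hεδ⟩
  have hsph : ∀ z ∈ Metric.sphere (0 : ℂ) ε, z ∈ Metric.ball (0 : ℂ) δ ∧ z ≠ 0 := by
    intro z hz
    exact ⟨Metric.sphere_subset_closedBall.trans (Metric.closedBall_subset_ball hεδ) hz,
      ne_of_mem_of_not_mem hz (by simp [hε0.ne])⟩
  have hana : ∀ z ∈ Metric.closedBall (0 : ℂ) ε, AnalyticAt ℂ A z ∧ AnalyticAt ℂ a z := by
    intro z hz
    rcases eq_or_ne z 0 with rfl | hne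
    · exact hAa
    · exact (hall z (Metric.closedBall_subset_ball hεδ hz) hne).2
  have hcauchy : ∀ B : ℂ → ℂ, (∀ z ∈ Metric.closedBall (0 : ℂ) ε, AnalyticAt ℂ B z) →
      (∮ z in C(0, ε), B z) = 0 ∧ CircleIntegrable B 0 ε := by
    intro B hB
    have hc : ContinuousOn B (Metric.closedBall 0 ε) :=
      fun z hz => (hB z hz).continuousAt.continuousWithinAt
    exact ⟨circleIntegral_eq_zero_of_differentiable_on_off_countable hε0.le Set.countable_empty hc
        fun z hz => (hB z (Metric.ball_subset_closedBall hz.1)).differentiableAt,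
      (hc.mono Metric.sphere_subset_closedBall).circleIntegrable hε0.le⟩
  have hE : ∀ k, ∀ z ∈ Metric.sphere (0 : ℂ) ε, AnalyticAt ℂ (iteratedDeriv k (thetaZeta τ)) z :=
    fun k z hz => analyticAt_iteratedDeriv_thetaZeta hτ k
      (hall z (hsph z hz).1 (hsph z hz).2).1.2.2
  have hEint : ∀ k, CircleIntegrable (iteratedDeriv k (thetaZeta τ)) 0 ε := fun k =>
    ContinuousOn.circleIntegrable hε0.le fun z hz => (hE k z hz).continuousAt.continuousWithinAt
  have hE0 : (∮ z in C(0, ε), iteratedDeriv 0 (thetaZeta τ) z) = 2 * Real.pi * I := by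
    have h1 := circleIntegral.integral_congr (g := fun z => (z - 0)⁻¹ + a z) hε0.le
      fun z hz => (hall z (hsph z hz).1 (hsph z hz).2).1.2.1.trans (by simp)
    have h2 := hcauchy a fun z hz => (hana z hz).2
    rw [h1, circleIntegral.integral_add _ h2.2, h2.1,
      circleIntegral.integral_sub_center_inv 0 hε0.ne', add_zero]
    rw [circleIntegrable_sub_inv_iff]
    right
    simp [(abs_pos.mpr hε0.ne').ne]
  have hEk : ∀ k, (∮ z in C(0, ε), iteratedDeriv (k + 1) (thetaZeta τ) z) = 0 := by
    intro k
    refine circleIntegral.integral_eq_zero_of_hasDerivWithinAt hε0.le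
      (f := iteratedDeriv k (thetaZeta τ)) fun z hz => ?_
    rw [iteratedDeriv_succ]
    exact (hE k z hz).differentiableAt.hasDerivAt.hasDerivWithinAt
  rw [circleIntegral.integral_congr hε0.le
    fun z hz => (hall z (hsph z hz).1 (hsph z hz).2).1.1]
  have hA' := hcauchy A fun z hz => (hana z hz).1
  have hint : ∀ k, CircleIntegrable (fun z => c k * iteratedDeriv k (thetaZeta τ) z) 0 ε :=
    fun k => (hEint k).const_smul
  rw [circleIntegral.integral_add (CircleIntegrable.fun_sum _ fun k _ => hint k) hA'.2, hA'.1,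
    circleIntegral.integral_fun_sum fun k _ => hint k, Finset.sum_range_succ']
  simp only [circleIntegral.integral_const_mul, hEk, hE0]
  simp
  ring

end ThetaZeta

section EllipticGenus

open Filter Topology

variable {τ : ℂ}

/-- The integrand of the residue formula for the elliptic genus of a degree-`m` hypersurface in
`ℂP^{N-1}`. -/
noncomputable def genusIntegrand (τ v : ℂ) (m N : ℕ) (z : ℂ) : ℂ :=
  theta ((m : ℂ) * z) τ / theta (v + (m : ℂ) * z) τ * (theta (v + z) τ / theta z τ) ^ N

/-- The poles of the integrand outside the lattice `ℤ + ℤτ`. -/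
noncomputable def genusPole (τ v : ℂ) (m : ℕ) (a b : ℕ) : ℂ := (-v + a + b * τ) / m

lemma genusIntegrand_add_lattice (hτ : 0 < τ.im) {v : ℂ} {m N : ℕ}
    (hint : ∃ k : ℤ, ((N : ℂ) - (m : ℂ)) * v = (k : ℂ)) (a b : ℤ) (z : ℂ) :
    genusIntegrand τ v m N (z + (a + b * τ)) = genusIntegrand τ v m N z := by
  obtain ⟨k, hk⟩ := hint
  have h1 := theta_div_add_lattice hτ (m * a) (m * b) (m * z) (v + m * z)
  have h2 := theta_div_add_lattice hτ a b (v + z) z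
  rw [genusIntegrand, genusIntegrand,
    show (m : ℂ) * (z + (a + b * τ)) = m * z + ((m * a : ℤ) + (m * b : ℤ) * τ) by
      push_cast; ring, ← add_assoc v, ← add_assoc v, h1, h2, mul_pow, ← exp_nat_mul]
  have e : exp (2 * (Real.pi : ℂ) * I * (m * b : ℤ) * (v + m * z - m * z)) *
      exp (N * (2 * (Real.pi : ℂ) * I * b * (z - (v + z)))) = 1 := by
    rw [← exp_add, exp_eq_one_iff]
    refine ⟨-(b * k), ?_⟩
    push_cast
    linear_combination (-2 * (Real.pi : ℂ) * I * b) * hk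
  linear_combination (theta (m * z) τ / theta (v + m * z) τ *
    (theta (v + z) τ / theta z τ) ^ N) * e

lemma theta_genusPole_sub_ne_zero (hτ : 0 < τ.im) (v : ℂ) {m a b a' b' : ℕ} (ha : a < m)
    (hb : b < m) (ha' : a' < m) (hb' : b' < m) (h : (a, b) ≠ (a', b')) :
    theta (genusPole τ v m a b - genusPole τ v m a' b') τ ≠ 0 := by
  intro h0
  have hm : (m : ℂ) ≠ 0 := by
    norm_cast
    omega
  obtain ⟨A, B, hAB⟩ := exists_eq_of_theta_eq_zero hτ h0
  have key : (((a : ℤ) - a' - m * A : ℤ) : ℂ) + ((b : ℤ) - b' - m * B : ℤ) * τ = 0 := by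
    rw [genusPole, genusPole, ← sub_div, div_eq_iff hm] at hAB
    push_cast
    linear_combination hAB
  have hB : (b : ℤ) - b' - m * B = 0 := by
    have := congrArg Complex.im key
    rw [add_im, mul_im, intCast_im, intCast_im, intCast_re, zero_mul, add_zero, zero_add,
      zero_im] at this
    exact_mod_cast (mul_eq_zero.mp this).resolve_right hτ.ne'
  have hA : (a : ℤ) - a' - m * A = 0 := by
    rw [hB, Int.cast_zero, zero_mul, add_zero] at key
    exact Int.cast_eq_zero.mp key
  have eq_of : ∀ {x y : ℕ} {C : ℤ}, x < m → y < m → (x : ℤ) - y - m * C = 0 → x = y := by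
    intro x y C hx hy hC
    have : (x : ℤ) ≡ y [ZMOD m] := (Int.modEq_iff_dvd.mpr ⟨-C, by linarith⟩)
    exact Nat.ModEq.eq_of_lt_of_lt (Int.natCast_modEq_iff.mp this) hx hy
  exact h (Prod.ext (eq_of ha ha' hA) (eq_of hb hb' hB))

lemma exists_theta_sub_genusPole_eq_zero (hτ : 0 < τ.im) {v z : ℂ} {m : ℕ} (hm : 0 < m)
    (hz : theta (v + m * z) τ = 0) :
    ∃ a < m, ∃ b < m, theta (z - genusPole τ v m a b) τ = 0 := by
  obtain ⟨A, B, h⟩ := exists_eq_of_theta_eq_zero hτ hz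
  have hm' : (m : ℂ) ≠ 0 := by exact_mod_cast hm.ne'
  have hmod : ∀ C : ℤ, ∃ c < m, ∃ D : ℤ, C = c + m * D := by
    intro C
    have hpos : (0 : ℤ) < m := by exact_mod_cast hm
    refine ⟨(C % m).toNat, ?_, C / m, ?_⟩
    · have := Int.emod_lt_of_pos C hpos
      omega
    · rw [Int.toNat_of_nonneg (Int.emod_nonneg _ hpos.ne'), Int.emod_add_mul_ediv]
  obtain ⟨a, ha, A', rfl⟩ := hmod A
  obtain ⟨b, hb, B', rfl⟩ := hmod B
  refine ⟨a, ha, b, hb, (theta_eq_zero_iff hτ _).mpr ⟨A', B', ?_⟩⟩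
  rw [genusPole]
  push_cast at h
  field_simp
  linear_combination h

lemma analyticAt_genusIntegrand (hτ : 0 < τ.im) {v z : ℂ} {m N : ℕ} (hz : theta z τ ≠ 0)
    (hvz : theta (v + m * z) τ ≠ 0) : AnalyticAt ℂ (genusIntegrand τ v m N) z := by
  have hd := differentiable_theta hτ
  have h1 : AnalyticAt ℂ (fun z => theta (m * z) τ) z :=
    (hd.comp (g := fun z => theta z τ) (f := fun z => (m : ℂ) * z) (by fun_prop)).analyticAt z
  have h2 : AnalyticAt ℂ (fun z => theta (v + m * z) τ) z :=
    (hd.comp (g := fun z => theta z τ) (f := fun z => v + (m : ℂ) * z) (by fun_prop)).analyticAt z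
  have h3 : AnalyticAt ℂ (fun z => theta (v + z) τ) z :=
    (hd.comp (g := fun z => theta z τ) (f := fun z => v + z) (by fun_prop)).analyticAt z
  exact (h1.div h2 hvz).mul ((h3.div (analyticAt_theta hτ z) hz).pow N)

lemma genusIntegrand_eventuallyEq_zero (hτ : 0 < τ.im) {v : ℂ} (m : ℕ) {N : ℕ}
    (hθv : theta v τ ≠ 0) : ∃ g : ℂ → ℂ, AnalyticAt ℂ g 0 ∧
      genusIntegrand τ v m N =ᶠ[𝓝[≠] 0] fun z => g z / (z - 0) ^ N := by
  obtain ⟨T, hT, hT0, hθT⟩ := exists_theta_eq_mul hτ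
  have hd := differentiable_theta hτ
  have hT0' : T 0 ≠ 0 := hT0 ▸ deriv_theta_zero_ne_zero hτ
  refine ⟨fun z => theta (m * z) τ / theta (v + m * z) τ * (theta (v + z) τ / T z) ^ N, ?_, ?_⟩
  · have h1 : AnalyticAt ℂ (fun z => theta (m * z) τ) 0 :=
      (hd.comp (g := fun z => theta z τ) (f := fun z => (m : ℂ) * z) (by fun_prop)).analyticAt 0
    have h2 : AnalyticAt ℂ (fun z => theta (v + m * z) τ) 0 :=
      (hd.comp (g := fun z => theta z τ) (f := fun z => v + (m : ℂ) * z)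
        (by fun_prop)).analyticAt 0
    have h3 : AnalyticAt ℂ (fun z => theta (v + z) τ) 0 :=
      (hd.comp (g := fun z => theta z τ) (f := fun z => v + z) (by fun_prop)).analyticAt 0
    exact (h1.div h2 (by simpa using hθv)).mul ((h3.div (hT.analyticAt 0) hT0').pow N)
  · refine Eventually.of_forall fun z => ?_
    simp only [genusIntegrand, hθT z, sub_zero]
    rw [mul_comm z, ← div_div, div_pow (theta (v + z) τ / T z), mul_div_assoc]

lemma genusIntegrand_eventuallyEq_genusPole (hτ : 0 < τ.im) {v : ℂ} {m N a b : ℕ} (hm : 0 < m)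
    (hz : theta (genusPole τ v m a b) τ ≠ 0) : ∃ g : ℂ → ℂ,
      AnalyticAt ℂ g (genusPole τ v m a b) ∧
      g (genusPole τ v m a b) = exp (2 * (Real.pi : ℂ) * I * (b : ℂ) * v) *
        (-theta v τ / (m * deriv (fun v => theta v τ) 0)) *
        (theta (v + genusPole τ v m a b) τ / theta (genusPole τ v m a b) τ) ^ N ∧
      genusIntegrand τ v m N =ᶠ[𝓝[≠] genusPole τ v m a b]
        fun z => g z / (z - genusPole τ v m a b) ^ (0 + 1) := by
  obtain ⟨T, hT, hT0, hθT⟩ := exists_theta_eq_mul hτ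
  have hd := differentiable_theta hτ
  have hT0' : T 0 ≠ 0 := hT0 ▸ deriv_theta_zero_ne_zero hτ
  have hm' : (m : ℂ) ≠ 0 := by exact_mod_cast hm.ne'
  set p := genusPole τ v m a b with hp
  have hmp : (m : ℂ) * p = -v + a + b * τ := by
    rw [hp, genusPole, mul_div_cancel₀ _ hm']
  refine ⟨fun z => exp (2 * (Real.pi : ℂ) * I * (b : ℂ) * v) *
    (theta (m * z - (a + b * τ)) τ / (m * T (m * (z - p)))) *
    (theta (v + z) τ / theta z τ) ^ N, ?_, ?_, ?_⟩
  · have h1 : AnalyticAt ℂ (fun z => theta (m * z - (a + b * τ)) τ) p :=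
      (hd.comp (g := fun z => theta z τ) (f := fun z => (m : ℂ) * z - (a + b * τ))
        (by fun_prop)).analyticAt p
    have h2 : AnalyticAt ℂ (fun z => m * T (m * (z - p))) p :=
      ((hT.comp (f := fun z => (m : ℂ) * (z - p)) (by fun_prop)).const_mul (m : ℂ)).analyticAt p
    have h3 : AnalyticAt ℂ (fun z => theta (v + z) τ) p :=
      (hd.comp (g := fun z => theta z τ) (f := fun z => v + z) (by fun_prop)).analyticAt p
    exact (analyticAt_const.mul (h1.div h2 (by simp [hm', hT0']))).mul
      ((h3.div (analyticAt_theta hτ p) hz).pow N)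
  · simp only [sub_self, mul_zero, hT0]
    rw [hmp, show -v + a + b * τ - (a + b * τ) = -v by ring, theta_neg hτ]
  · refine Eventually.of_forall fun z => ?_
    have h := theta_div_add_lattice hτ a b (m * z - (a + b * τ)) (m * (z - p))
    have e1 : (m : ℂ) * z - (a + b * τ) + ((a : ℤ) + (b : ℤ) * τ) = m * z := by
      push_cast; ring
    have e2 : (m : ℂ) * (z - p) + ((a : ℤ) + (b : ℤ) * τ) = v + m * z := by
      push_cast; linear_combination -hmp
    have e3 : (m : ℂ) * (z - p) - (m * z - (a + b * τ)) = v := by linear_combination -hmp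
    rw [e1, e2, e3, hθT (m * (z - p)), show (m : ℂ) * (z - p) * T (m * (z - p)) =
      m * T (m * (z - p)) * (z - p) by ring, ← div_div] at h
    simp only [genusIntegrand, h, zero_add, pow_one, Int.cast_natCast]
    ring

end EllipticGenus

/-- Theorem 6.1 (Calabi-Yau/Landau-Ginzburg correspondence): the elliptic genus
of a degree-`m` hypersurface in `ℂP^{N-1}`, expressed as a contour integral,
equals the Landau-Ginzburg orbifold expression
`(1/m)·∑_{a,b=0}^{m−1} e^{2πibv}·(θ((m−1)v/m + (a+bτ)/m, τ)/θ(−v/m + (a+bτ)/m, τ))^N`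
whenever `(N−m)v` is an integer. -/
theorem elliptic_genus_eq_LG_orbifold
    (τ : ℂ) (hτ : 0 < τ.im) (v : ℂ) (m N : ℕ) (hm : 1 ≤ m) (hN : 2 ≤ N)
    (hint : ∃ k : ℤ, ((N : ℂ) - (m : ℂ)) * v = (k : ℂ))
    (hθv : theta v τ ≠ 0)
    (hz : ∀ a b : ℕ, a < m → b < m →
      theta ((-v + a + b * τ) / m) τ ≠ 0 ∧
        theta ((((m : ℂ) - 1) * v + a + b * τ) / m) τ ≠ 0) :
    ∀ᶠ ε in nhdsWithin (0 : ℝ) (Set.Ioi 0),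
      -(1 / Gfun v τ) *
          (∮ z in C(0, ε),
            theta ((m : ℂ) * z) τ / theta (v + (m : ℂ) * z) τ *
              (theta (v + z) τ / theta z τ) ^ N) =
        (1 / m) *
          ∑ a ∈ Finset.range m, ∑ b ∈ Finset.range m,
            exp (2 * (Real.pi : ℂ) * I * (b : ℂ) * v) *
              (theta ((((m : ℂ) - 1) * v + a + b * τ) / m) τ /
                theta ((-v + a + b * τ) / m) τ) ^ N := by
  have hm0 : (m : ℂ) ≠ 0 := by exact_mod_cast (by omega : m ≠ 0)
  have hD := deriv_theta_zero_ne_zero hτ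
  set D := deriv (fun v => theta v τ) 0 with hDdef
  let s : Option (Fin m × Fin m) → ℂ := fun i => i.elim 0 fun p => genusPole τ v m p.1 p.2
  let n : Option (Fin m × Fin m) → ℕ := fun i => i.elim (N - 1) fun _ => 0
  let r : Fin m × Fin m → ℂ := fun p => exp (2 * (Real.pi : ℂ) * I * ((p.2 : ℕ) : ℂ) * v) *
    (-theta v τ / (m * D)) *
      (theta (v + genusPole τ v m p.1 p.2) τ / theta (genusPole τ v m p.1 p.2) τ) ^ N
  have hpole : ∀ p : Fin m × Fin m, theta (genusPole τ v m p.1 p.2) τ ≠ 0 :=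
    fun p => (hz _ _ p.1.isLt p.2.isLt).1
  have hpp : ∀ i, ∃ c : ℕ → ℂ, (∀ p, i = some p → c 0 = r p) ∧ ∃ A : ℂ → ℂ,
      AnalyticAt ℂ A (s i) ∧ genusIntegrand τ v m N =ᶠ[nhdsWithin (s i) {s i}ᶜ] fun z =>
        ∑ k ∈ Finset.range (n i + 1), c k * iteratedDeriv k (thetaZeta τ) (z - s i) + A z := by
    rintro (_ | p)
    · obtain ⟨g, hg, h⟩ := genusIntegrand_eventuallyEq_zero hτ m (N := N) hθv
      obtain ⟨c, -, hc⟩ := exists_principalPart (f := genusIntegrand τ v m N) hτ 0 (N - 1) hg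
        (by rwa [Nat.sub_add_cancel (by omega)])
      exact ⟨c, by simp, hc⟩
    · obtain ⟨g, hg, hgp, h⟩ := genusIntegrand_eventuallyEq_genusPole hτ hm (N := N) (hpole p)
      obtain ⟨c, hc0, hc⟩ := exists_principalPart hτ _ 0 hg h
      refine ⟨c, fun p' hp' => ?_, hc⟩
      obtain rfl := Option.some.inj hp'
      rw [hc0 rfl, hgp]
  choose c hcr hc using hpp
  have hs : ∀ i j, i ≠ j → theta (s i - s j) τ ≠ 0 := by
    rintro (_ | p) (_ | p') hne
    · exact absurd rfl hne
    · simpa [s, theta_neg hτ] using hpole p'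
    · simpa [s] using hpole p
    · refine theta_genusPole_sub_ne_zero hτ v p.1.isLt p.2.isLt p'.1.isLt p'.2.isLt fun h => hne ?_
      rw [Prod.mk.injEq] at h
      exact congrArg some (Prod.ext (Fin.ext h.1) (Fin.ext h.2))
  have hsum := sum_residue_eq_zero hτ hs (genusIntegrand_add_lattice hτ hint) (fun z hz' => by
    refine analyticAt_genusIntegrand hτ (by simpa [s] using hz' none) fun h0 => ?_
    obtain ⟨a, ha, b, hb, h⟩ := exists_theta_sub_genusPole_eq_zero hτ hm h0
    exact hz' (some (⟨a, ha⟩, ⟨b, hb⟩)) h) hc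
  rw [Fintype.sum_option, Finset.sum_congr rfl fun p _ => hcr (some p) p rfl] at hsum
  have hr : ∑ p, r p = -theta v τ / (m * D) *
      ∑ a ∈ Finset.range m, ∑ b ∈ Finset.range m, exp (2 * (Real.pi : ℂ) * I * (b : ℂ) * v) *
        (theta ((((m : ℂ) - 1) * v + a + b * τ) / m) τ /
          theta ((-v + a + b * τ) / m) τ) ^ N := by
    simp only [Finset.sum_range, Fintype.sum_prod_type, Finset.mul_sum]
    refine Finset.sum_congr rfl fun a _ => Finset.sum_congr rfl fun b _ => ?_
    have : v + genusPole τ v m a b = (((m : ℂ) - 1) * v + a + b * τ) / m := by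
      rw [genusPole]
      field_simp
      ring
    simp only [r, this]
    rw [genusPole]
    ring
  have hG := Gfun_mul_deriv_theta hτ v
  rw [← hDdef] at hG
  have hG0 : Gfun v τ ≠ 0 := by
    intro h0
    rw [h0, zero_mul] at hG
    exact mul_ne_zero (neg_ne_zero.mpr two_pi_I_ne_zero) hθv hG.symm
  obtain ⟨A, hA, hfA⟩ := hc none
  filter_upwards [eventually_circleIntegral_eq hτ (c := c none) hA (by simpa [s] using hfA)]
    with ε hε
  simp only [genusIntegrand] at hε
  rw [hε]
  rw [hr] at hsum
  set S := ∑ a ∈ Finset.range m, ∑ b ∈ Finset.range m, exp (2 * (Real.pi : ℂ) * I * (b : ℂ) * v) *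
    (theta ((((m : ℂ) - 1) * v + a + b * τ) / m) τ / theta ((-v + a + b * τ) / m) τ) ^ N
  rw [eq_neg_of_add_eq_zero_left hsum]
  field_simp
  linear_combination -S * hG
end
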